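/- Set K := A+1+D and H := B+2+2D in R. Let l ≥ 1, k ≥ 0, l' ≥ 0 be integers, let p ∈ ℤ, and let u be a unit of the ring R. If (K−2H+D+5)^{2l+k}·(8·(1−D))^{l'+1}·p = (K−2H+D+5)^{k}·(8·(1−D))^{l+l'+1}·u in R, then p = 1 or p = −1. In particular, no such identity can hold with p even. -/

import Mathlib

noncomputable section

open MvPolynomial

abbrev PDab : Type := MvPolynomial (Fin 3) ℤ

/-- Relations `D² − 1`, `D·A − A`, `D·B − B`, `B² − 4(A − 2B)` with `D, A, B = X 0, X 1, X 2`. -/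
def relsDAB : Set PDab :=
  {X 0 ^ 2 - 1, X 0 * X 1 - X 1, X 0 * X 2 - X 2, X 2 ^ 2 - 4 * (X 1 - 2 * X 2)}

/-- The ring `ℤ[D,A,B]/(D²−1, D·A−A, D·B−B, B²−4(A−2B))`, i.e. `RO(Pin(2))`. -/
abbrev RO : Type := PDab ⧸ Ideal.span relsDAB

def Dv : RO := Ideal.Quotient.mk (Ideal.span relsDAB) (X 0)
def Av : RO := Ideal.Quotient.mk (Ideal.span relsDAB) (X 1)
def Bv : RO := Ideal.Quotient.mk (Ideal.span relsDAB) (X 2)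

/-- The element `K = A + 1 + D` of `R`. -/
def Kv : RO := Av + 1 + Dv

/-- The element `H = B + 2 + 2D` of `R`. -/
def Hv : RO := Bv + 2 + 2 * Dv

/-- The homomorphism with `D ↦ -1`, `A, B ↦ 0`. -/
def phiZero : RO →+* ℤ :=
  Ideal.Quotient.lift (Ideal.span relsDAB) (MvPolynomial.eval (![-1, 0, 0] : Fin 3 → ℤ)) (by
    intro a ha
    have h : Ideal.span relsDAB ≤ RingHom.ker (MvPolynomial.eval (![-1, 0, 0] : Fin 3 → ℤ)) := by
      rw [Ideal.span_le]
      intro x hx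
      simp only [relsDAB, Set.mem_insert_iff, Set.mem_singleton_iff] at hx
      rcases hx with rfl | rfl | rfl | rfl <;> simp [RingHom.mem_ker]
    exact h ha)

theorem phiZero_D : phiZero Dv = -1 := by
  refine (Ideal.Quotient.lift_mk _ _ _).trans ?_
  simp
theorem phiZero_A : phiZero Av = 0 := by
  refine (Ideal.Quotient.lift_mk _ _ _).trans ?_
  simp
theorem phiZero_B : phiZero Bv = 0 := by
  refine (Ideal.Quotient.lift_mk _ _ _).trans ?_
  simp

/-- final contradiction in the proof of Proposition 3.1. If `l ≥ 1`, `u`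
is a unit of `R`, and
`(K−2H+D+5)^{2l+k}·(8(1−D))^{l'+1}·p = (K−2H+D+5)^k·(8(1−D))^{l+l'+1}·u` in `R`,
then `p = 1` or `p = −1`. -/
theorem prop_3_1_contradiction (l k l' : ℕ) (hl : 1 ≤ l) (p : ℤ) (u : RO) (hu : IsUnit u)
    (hyp : (Kv - 2 * Hv + Dv + 5) ^ (2 * l + k) * (8 * (1 - Dv)) ^ (l' + 1) * (p : RO) =
      (Kv - 2 * Hv + Dv + 5) ^ k * (8 * (1 - Dv)) ^ (l + l' + 1) * u) :
    p = 1 ∨ p = -1 := by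
  have h1 : phiZero (Kv - 2 * Hv + Dv + 5) = 4 := by
    simp only [Kv, Hv, map_add, map_sub, map_mul, map_one, map_ofNat, phiZero_D, phiZero_A,
      phiZero_B]
    norm_num
  have h2 : phiZero (8 * (1 - Dv)) = 16 := by
    simp only [map_sub, map_mul, map_one, map_ofNat, phiZero_D]
    norm_num
  have h := congrArg phiZero hyp
  rw [map_mul, map_mul, map_mul, map_mul, map_pow, map_pow, map_pow, map_pow, h1, h2,
    map_intCast, Int.cast_id] at h
  have e : (4 : ℤ) ^ (2 * l + k) * 16 ^ (l' + 1) = 4 ^ k * 16 ^ (l + l' + 1) := by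
    rw [pow_add, pow_mul, show l + l' + 1 = l + (l' + 1) by ring, pow_add 16 l]
    norm_num
    ring
  rw [e] at h
  have hp : p = phiZero u := mul_left_cancel₀ (by positivity) h
  rw [hp]
  exact Int.isUnit_iff.mp (hu.map phiZero)
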